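/- arXiv:1311.5803 — 5 statements merged into one kernel-verified Lean document; each statement's English description precedes it below -/
import Mathlib

section
/- (Perturbation Lemma, Brown–Gugenheim) Let (D, C, f, g, h) be a filtered contraction of chain complexes of R-modules, and let t be a perturbation of C that lowers the filtration. Set S = Σ_{n≥0} t(ht)^n (a well-defined map since t lowers the bounded-below exhaustive filtration), and define f' = f + fSh, g' = g + hSg, h' = h + hSh, and t' = fSg. Then t' is a perturbation of D, and (D^{t'}, C^{t}, f', g', h') is a contraction, where C^{t} denotes C with differential d_C + t and D^{t'} denotes D with differential d_D + t'. -/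
noncomputable section

open DirectSum

universe u v

section Perturbation

variable (R : Type u) [Ring R]

/-- A linear map between the total modules of two `ℤ`-graded modules has
degree `k` if all its components outside degree `k` vanish. -/
def HasDeg (A B : ℤ → Type v)
    [∀ n, AddCommGroup (A n)] [∀ n, Module R (A n)]
    [∀ n, AddCommGroup (B n)] [∀ n, Module R (B n)]
    (F : (⨁ n, A n) →ₗ[R] ⨁ n, B n) (k : ℤ) : Prop :=
  ∀ m n : ℤ, n ≠ m + k →
    DirectSum.component R ℤ B n ∘ₗ F ∘ₗ DirectSum.lof R ℤ A m = 0

/-- `(D, C, f, g, h)` is a contraction of chain complexes: `dC` and `dD` are the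
(degree `-1`, square zero) differentials on the chain complexes `C` and `D` with
underlying graded modules `Cf` and `Df`, `f` and `g` are chain maps, `h` has
degree `1`, and `fg = 1`, `gf = 1 + dh + hd`, `fh = 0`, `hg = 0`, `h² = 0`. -/
structure IsContraction (Cf Df : ℤ → Type v)
    [∀ n, AddCommGroup (Cf n)] [∀ n, Module R (Cf n)]
    [∀ n, AddCommGroup (Df n)] [∀ n, Module R (Df n)]
    (dC : (⨁ n, Cf n) →ₗ[R] ⨁ n, Cf n) (dD : (⨁ n, Df n) →ₗ[R] ⨁ n, Df n)
    (f : (⨁ n, Cf n) →ₗ[R] ⨁ n, Df n) (g : (⨁ n, Df n) →ₗ[R] ⨁ n, Cf n)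
    (h : (⨁ n, Cf n) →ₗ[R] ⨁ n, Cf n) : Prop where
  dC_sq : dC ∘ₗ dC = 0
  dD_sq : dD ∘ₗ dD = 0
  dC_deg : HasDeg R Cf Cf dC (-1)
  dD_deg : HasDeg R Df Df dD (-1)
  f_deg : HasDeg R Cf Df f 0
  g_deg : HasDeg R Df Cf g 0
  h_deg : HasDeg R Cf Cf h 1
  f_chain : f ∘ₗ dC = dD ∘ₗ f
  g_chain : g ∘ₗ dD = dC ∘ₗ g
  fg : f ∘ₗ g = LinearMap.id
  gf : g ∘ₗ f = LinearMap.id + dC ∘ₗ h + h ∘ₗ dC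
  fh : f ∘ₗ h = 0
  hg : h ∘ₗ g = 0
  hh : h ∘ₗ h = 0

end Perturbation
section LocallyNilpotent

variable {R : Type*} [Ring R] {M : Type*} [AddCommGroup M] [Module R M]

theorem finite_support_pow_apply {a : Module.End R M} {x : M} (hx : ∃ n : ℕ, (a ^ n) x = 0) :
    (Function.support fun n : ℕ => (a ^ n) x).Finite := by
  obtain ⟨N, hN⟩ := hx
  refine (Set.finite_Iio N).subset fun n hn => ?_
  by_contra hlt
  simp only [Set.mem_Iio, not_lt] at hlt
  refine hn ?_
  change (a ^ n) x = 0
  rw [← Nat.sub_add_cancel hlt, pow_add, Module.End.mul_apply, hN, map_zero]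

/-- The geometric series `Σ_{n ≥ 0} aⁿ` of a locally nilpotent endomorphism. -/
def geomSeries (a : Module.End R M) (ha : ∀ x, ∃ n : ℕ, (a ^ n) x = 0) : Module.End R M where
  toFun x := ∑ᶠ n : ℕ, (a ^ n) x
  map_add' x y := by
    simp only [map_add]
    exact finsum_add_distrib (finite_support_pow_apply (ha x)) (finite_support_pow_apply (ha y))
  map_smul' c x := by
    simp only [map_smul, RingHom.id_apply]
    exact (smul_finsum' c (finite_support_pow_apply (ha x))).symm

theorem map_geomSeries {N : Type*} [AddCommGroup N] [Module R N] (φ : M →ₗ[R] N)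
    (a : Module.End R M) (ha : ∀ x, ∃ n : ℕ, (a ^ n) x = 0) (x : M) :
    φ (geomSeries a ha x) = ∑ᶠ n : ℕ, φ ((a ^ n) x) :=
  φ.toAddMonoidHom.map_finsum (finite_support_pow_apply (ha x))

theorem mul_geomSeries (a : Module.End R M) (ha : ∀ x, ∃ n : ℕ, (a ^ n) x = 0) :
    a * geomSeries a ha = geomSeries a ha * a := by
  ext x
  rw [Module.End.mul_apply, map_geomSeries, Module.End.mul_apply]
  change _ = ∑ᶠ n : ℕ, (a ^ n) (a x)
  simp only [← Module.End.mul_apply, ← pow_succ, ← pow_succ']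

theorem geomSeries_eq_one_add_mul (a : Module.End R M) (ha : ∀ x, ∃ n : ℕ, (a ^ n) x = 0) :
    geomSeries a ha = 1 + geomSeries a ha * a := by
  ext x
  obtain ⟨N, hN⟩ := ha x
  have hzero (n : ℕ) (hn : N ≤ n) : (a ^ n) x = 0 := by
    rw [← Nat.sub_add_cancel hn, pow_add, Module.End.mul_apply, hN, map_zero]
  have h₁ : geomSeries a ha x = ∑ n ∈ Finset.range (N + 1), (a ^ n) x := by
    refine finsum_eq_sum_of_support_subset _ fun n hn => ?_
    by_contra hlt
    exact hn (hzero n (by simp at hlt; omega))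
  have h₂ : geomSeries a ha (a x) = ∑ n ∈ Finset.range N, (a ^ (n + 1)) x := by
    simp only [pow_succ, Module.End.mul_apply]
    refine finsum_eq_sum_of_support_subset _ fun n hn => ?_
    by_contra hlt
    refine hn ?_
    change (a ^ n) (a x) = 0
    rw [← Module.End.mul_apply, ← pow_succ]
    exact hzero _ (by simp at hlt; omega)
  rw [LinearMap.add_apply, Module.End.mul_apply, h₁, h₂, Finset.sum_range_succ']
  simp [add_comm]

theorem exists_pow_apply_eq_zero_of_lowers_filtration {F : ℤ → Submodule R M} (hmono : Monotone F)
    (hbdd : ∃ N : ℤ, ∀ p ≤ N, F p = ⊥) (hexh : ⨆ p, F p = ⊤) {a : Module.End R M}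
    (ha : ∀ p, ∀ x ∈ F p, a x ∈ F (p - 1)) (x : M) : ∃ n : ℕ, (a ^ n) x = 0 := by
  obtain ⟨N, hN⟩ := hbdd
  obtain ⟨p, hp⟩ : ∃ p, x ∈ F p := by
    rw [← Submodule.mem_iSup_of_directed F hmono.directed_le, hexh]
    trivial
  have key (n : ℕ) : (a ^ n) x ∈ F (p - n) := by
    induction n with
    | zero => simpa using hp
    | succ n ih =>
      rw [pow_succ', Module.End.mul_apply]
      convert ha _ _ ih using 2
      push_cast
      ring
  refine ⟨(p - N).toNat, ?_⟩
  have := key (p - N).toNat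
  rwa [hN _ (by omega), Submodule.mem_bot] at this

end LocallyNilpotent

section HasDeg

variable {R : Type u} [Ring R] {A B C : ℤ → Type v}
  [∀ n, AddCommGroup (A n)] [∀ n, Module R (A n)]
  [∀ n, AddCommGroup (B n)] [∀ n, Module R (B n)]
  [∀ n, AddCommGroup (C n)] [∀ n, Module R (C n)]

theorem HasDeg.apply_lof {F : (⨁ n, A n) →ₗ[R] ⨁ n, B n} {k : ℤ} (hF : HasDeg R A B F k)
    {m n : ℤ} (hn : m + k = n) (v : A m) :
    F (lof R ℤ A m v) = lof R ℤ B n (component R ℤ B n (F (lof R ℤ A m v))) := by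
  refine DirectSum.ext_component R fun i => ?_
  by_cases hi : i = n
  · subst hi
    rw [component.lof_self]
  · rw [component.of, dif_neg (Ne.symm hi)]
    exact LinearMap.congr_fun (hF m i (by omega)) v

theorem HasDeg.comp {G : (⨁ n, B n) →ₗ[R] ⨁ n, C n} {F : (⨁ n, A n) →ₗ[R] ⨁ n, B n} {k l : ℤ}
    (hG : HasDeg R B C G l) (hF : HasDeg R A B F k) : HasDeg R A C (G ∘ₗ F) (k + l) := by
  intro m n hn
  ext1 v
  have := LinearMap.congr_fun (hG (m + k) n (by omega))
    (component R ℤ B (m + k) (F (lof R ℤ A m v)))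
  rw [LinearMap.comp_apply, LinearMap.comp_apply, ← hF.apply_lof rfl] at this
  exact this

theorem HasDeg.pow {F : Module.End R (⨁ n, A n)} (hF : HasDeg R A A F 0) (n : ℕ) :
    HasDeg R A A (F ^ n) 0 := by
  induction n with
  | zero =>
    intro m n hn
    ext1 v
    simp only [pow_zero, LinearMap.comp_apply, Module.End.one_apply]
    rw [component.of, dif_neg (by omega)]
    rfl
  | succ n ih => simpa [pow_succ, Module.End.mul_eq_comp] using ih.comp hF

end HasDeg

section PerturbationIdentities

variable {A : Type*} [Ring A] {d h t p S : A}

theorem perturbation_sum_identity (hp : p = 1 + d * h + h * d)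
    (ht : d * t + t * d + t * t = 0) (hSl : S = t + t * h * S) (hSr : S = t + S * h * t) :
    d * S + S * d + S * p * S = 0 := by
  have hl : (1 + S * h) * (1 - t * h) = 1 := by
    linear_combination (norm := noncomm_ring) hSr * h
  have hr : (1 - h * t) * (1 + h * S) = 1 := by
    linear_combination (norm := noncomm_ring) h * hSl
  have hl' : (1 - t * h) * S = t := by
    linear_combination (norm := noncomm_ring) hSl
  have hr' : S * (1 - h * t) = t := by
    linear_combination (norm := noncomm_ring) hSr
  have key : (1 - t * h) * (d * S + S * d + S * p * S) * (1 - h * t) = 0 := by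
    calc _ = (1 - t * h) * d * (S * (1 - h * t)) + (1 - t * h) * S * d * (1 - h * t)
          + (1 - t * h) * S * p * (S * (1 - h * t)) := by noncomm_ring
      _ = d * t + t * d + t * t := by
        rw [hl', hr', hp]
        noncomm_ring
      _ = 0 := ht
  calc _ = ((1 + S * h) * (1 - t * h)) * (d * S + S * d + S * p * S)
        * ((1 - h * t) * (1 + h * S)) := by rw [hl, hr, one_mul, mul_one]
    _ = (1 + S * h) * ((1 - t * h) * (d * S + S * d + S * p * S) * (1 - h * t))
        * (1 + h * S) := by noncomm_ring
    _ = 0 := by rw [key, mul_zero, zero_mul]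

theorem perturbed_projection_chain (hp : p = 1 + d * h + h * d) (hSr : S = t + S * h * t)
    (hS : d * S + S * d + S * p * S = 0) :
    (1 + S * h) * (d + t) = (d + S * p) * (1 + S * h) := by
  linear_combination (norm := noncomm_ring) -hSr - hS * h - S * hp

theorem perturbed_inclusion_chain (hp : p = 1 + d * h + h * d) (hSl : S = t + t * h * S)
    (hS : d * S + S * d + S * p * S = 0) :
    (1 + h * S) * (d + p * S) = (d + t) * (1 + h * S) := by
  linear_combination (norm := noncomm_ring) hSl + h * hS + hp * S

theorem perturbed_homotopy (hp : p = 1 + d * h + h * d)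
    (hSl : S = t + t * h * S) (hSr : S = t + S * h * t)
    (hS : d * S + S * d + S * p * S = 0) :
    (1 + h * S) * p * (1 + S * h)
      = 1 + (d + t) * (h + h * S * h) + (h + h * S * h) * (d + t) := by
  linear_combination (norm := noncomm_ring)
    hp + h * S * hp + hp * S * h + h * hS * h + hSl * h + h * hSr

end PerturbationIdentities

theorem perturbation_lemma
    (R : Type u) [Ring R] (Cf Df : ℤ → Type v)
    [∀ n, AddCommGroup (Cf n)] [∀ n, Module R (Cf n)]
    [∀ n, AddCommGroup (Df n)] [∀ n, Module R (Df n)]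
    (dC : (⨁ n, Cf n) →ₗ[R] ⨁ n, Cf n) (dD : (⨁ n, Df n) →ₗ[R] ⨁ n, Df n)
    (f : (⨁ n, Cf n) →ₗ[R] ⨁ n, Df n) (g : (⨁ n, Df n) →ₗ[R] ⨁ n, Cf n)
    (h : (⨁ n, Cf n) →ₗ[R] ⨁ n, Cf n)
    (hcon : IsContraction R Cf Df dC dD f g h)
    -- the contraction is filtered:
    (FC : ℤ → Submodule R (⨁ n, Cf n)) (FD : ℤ → Submodule R (⨁ n, Df n))
    (hFC_mono : Monotone FC) (hFD_mono : Monotone FD)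
    -- the filtrations are bounded below
    (hFC_bdd : ∃ N : ℤ, ∀ p ≤ N, FC p = ⊥) (hFD_bdd : ∃ N : ℤ, ∀ p ≤ N, FD p = ⊥)
    -- the filtrations are exhaustive
    (hFC_exh : ⨆ p, FC p = ⊤) (hFD_exh : ⨆ p, FD p = ⊤)
    -- the filtrations are preserved by the differentials and by `f`, `g`, `h`
    (hdC_filt : ∀ p, ∀ x ∈ FC p, dC x ∈ FC p)
    (hdD_filt : ∀ p, ∀ y ∈ FD p, dD y ∈ FD p)
    (hf_filt : ∀ p, ∀ x ∈ FC p, f x ∈ FD p)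
    (hg_filt : ∀ p, ∀ y ∈ FD p, g y ∈ FC p)
    (hh_filt : ∀ p, ∀ x ∈ FC p, h x ∈ FC p)
    -- `t` is a perturbation of `C` which lowers the filtration
    (t : (⨁ n, Cf n) →ₗ[R] ⨁ n, Cf n)
    (ht_deg : HasDeg R Cf Cf t (-1))
    (ht_sq : (dC + t) ∘ₗ (dC + t) = 0)
    (ht_low : ∀ p, ∀ x ∈ FC p, t x ∈ FC (p - 1))
    -- `S = Σ_{n ≥ 0} t(ht)ⁿ`, `f' = f + fSh`, `g' = g + hSg`, `h' = h + hSh`,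
    -- `t' = fSg`
    (S : (⨁ n, Cf n) → ⨁ n, Cf n)
    (hS : ∀ x, S x = ∑ᶠ n : ℕ, t (((h ∘ₗ t) ^ n) x))
    (f' : (⨁ n, Cf n) → ⨁ n, Df n)
    (hf' : ∀ x, f' x = f x + f (S (h x)))
    (g' : (⨁ n, Df n) → ⨁ n, Cf n)
    (hg' : ∀ y, g' y = g y + h (S (g y)))
    (h' : (⨁ n, Cf n) → ⨁ n, Cf n)
    (hh' : ∀ x, h' x = h x + h (S (h x)))
    (t' : (⨁ n, Df n) → ⨁ n, Df n)
    (ht' : ∀ y, t' y = f (S (g y))) :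
    -- `t'` is a perturbation of `D`: it has degree `-1` and `(dD + t')² = 0`
    (∀ (m : ℤ) (v : Df m) (n : ℤ), n ≠ m - 1 →
      DirectSum.component R ℤ Df n (t' (DirectSum.lof R ℤ Df m v)) = 0) ∧
    (∀ y : ⨁ n, Df n, dD (dD y + t' y) + t' (dD y + t' y) = 0) ∧
    -- `f' : C^t → D^{t'}` and `g' : D^{t'} → C^t` are chain maps
    (∀ x : ⨁ n, Cf n, f' (dC x + t x) = dD (f' x) + t' (f' x)) ∧
    (∀ y : ⨁ n, Df n, g' (dD y + t' y) = dC (g' y) + t (g' y)) ∧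
    -- the contraction identities for `(D^{t'}, C^t, f', g', h')`
    (∀ y : ⨁ n, Df n, f' (g' y) = y) ∧
    (∀ x : ⨁ n, Cf n, g' (f' x) = x + (dC (h' x) + t (h' x)) + h' (dC x + t x)) ∧
    (∀ x : ⨁ n, Cf n, f' (h' x) = 0) ∧
    (∀ y : ⨁ n, Df n, h' (g' y) = 0) ∧
    (∀ x : ⨁ n, Cf n, h' (h' x) = 0) := by
  have hlow (p : ℤ) (x) (hx : x ∈ FC p) : (h ∘ₗ t) x ∈ FC (p - 1) :=
    hh_filt _ _ (ht_low p x hx)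
  have hnil := exists_pow_apply_eq_zero_of_lowers_filtration hFC_mono hFC_bdd hFC_exh hlow
  let G : Module.End R (⨁ n, Cf n) := geomSeries (h ∘ₗ t) hnil
  let s : Module.End R (⨁ n, Cf n) := t * G
  let d : Module.End R (⨁ n, Cf n) := dC
  let k : Module.End R (⨁ n, Cf n) := h
  let τ : Module.End R (⨁ n, Cf n) := t
  let p : Module.End R (⨁ n, Cf n) := g ∘ₗ f
  have hSs (x) : S x = s x := by
    rw [hS]
    exact (map_geomSeries t (h ∘ₗ t) hnil x).symm
  have hG : G = 1 + G * (k * τ) := geomSeries_eq_one_add_mul (h ∘ₗ t) hnil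
  have hGc : k * τ * G = G * (k * τ) := mul_geomSeries (h ∘ₗ t) hnil
  have hSr : s = τ + s * k * τ := by
    linear_combination (norm := (simp only [s, τ]; noncomm_ring)) τ * hG
  have hSl : s = τ + τ * k * s := by
    linear_combination (norm := (simp only [s, τ]; noncomm_ring)) τ * hG - τ * hGc
  have hp : p = 1 + d * k + k * d := hcon.gf
  have htt : d * τ + τ * d + τ * τ = 0 := by
    have hdd : d * d = 0 := hcon.dC_sq
    have hsq : (d + τ) * (d + τ) = 0 := ht_sq
    linear_combination (norm := noncomm_ring) hsq - hdd
  have hs := perturbation_sum_identity hp htt hSl hSr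
  have hf_chain (x) : f (dC x) = dD (f x) := LinearMap.congr_fun hcon.f_chain x
  have hg_chain (y) : g (dD y) = dC (g y) := LinearMap.congr_fun hcon.g_chain y
  have hfg (y) : f (g y) = y := LinearMap.congr_fun hcon.fg y
  have hfh (x) : f (h x) = 0 := LinearMap.congr_fun hcon.fh x
  have hhg (y) : h (g y) = 0 := LinearMap.congr_fun hcon.hg y
  have hhh (x) : h (h x) = 0 := LinearMap.congr_fun hcon.hh x
  simp only [hf', hg', hh', ht', hSs]
  refine ⟨fun m v n hn => ?_, fun y => ?_, fun x => ?_, fun y => ?_, fun y => ?_, fun x => ?_,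
    fun x => ?_, fun y => ?_, fun x => ?_⟩
  · have hterm (i : ℕ) : component R ℤ Df n (f (t (((h ∘ₗ t) ^ i) (g (lof R ℤ Df m v))))) = 0 := by
      have hht : HasDeg R Cf Cf (h ∘ₗ t) 0 := hcon.h_deg.comp ht_deg
      have hdeg := hcon.f_deg.comp (ht_deg.comp ((hht.pow i).comp hcon.g_deg))
      exact LinearMap.congr_fun (hdeg m n (by omega)) v
    change (component R ℤ Df n ∘ₗ f ∘ₗ t) (geomSeries (h ∘ₗ t) hnil _) = 0
    rw [map_geomSeries]
    exact (finsum_congr hterm).trans finsum_zero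
  · have hy := congrArg f (LinearMap.congr_fun hs (g y))
    have hdd : dD (dD y) = 0 := LinearMap.congr_fun hcon.dD_sq y
    simp only [LinearMap.add_apply, Module.End.mul_apply, LinearMap.zero_apply, map_add, map_zero,
      d, p, LinearMap.comp_apply, hf_chain] at hy
    simp only [map_add, hdd, hg_chain, zero_add]
    rw [← add_assoc]
    exact hy
  · have hx := congrArg f (LinearMap.congr_fun (perturbed_projection_chain hp hSr hs) x)
    simp only [LinearMap.add_apply, Module.End.mul_apply, Module.End.one_apply, map_add,
      d, p, k, τ, LinearMap.comp_apply, hf_chain] at hx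
    simp only [map_add, hf_chain]
    refine sub_eq_zero.mp (Eq.trans ?_ (sub_eq_zero.mpr hx))
    abel
  · have hy := LinearMap.congr_fun (perturbed_inclusion_chain hp hSl hs) (g y)
    simp only [LinearMap.add_apply, Module.End.mul_apply, Module.End.one_apply, map_add,
      d, p, k, τ, LinearMap.comp_apply] at hy
    simp only [map_add, hg_chain]
    refine sub_eq_zero.mp (Eq.trans ?_ (sub_eq_zero.mpr hy))
    abel
  · simp [hfg, hfh, hhg, hhh]
  · have hx := LinearMap.congr_fun (perturbed_homotopy hp hSl hSr hs) x
    simp only [LinearMap.add_apply, Module.End.mul_apply, Module.End.one_apply, map_add,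
      d, p, k, τ, LinearMap.comp_apply] at hx
    simp only [map_add]
    refine sub_eq_zero.mp (Eq.trans ?_ (sub_eq_zero.mpr hx))
    abel
  · simp [hfh, hhh]
  · simp [hhg, hhh]
  · simp [hhh]
end
end

section
/- Let C be a based complex of R-modules with a Morse matching M. Then the diagram (C̃^M, C̃, f̃, g̃, h̃) is a contraction; that is, f̃ and g̃ are chain maps and the identities f̃g̃ = 1, g̃f̃ = 1 + d̃h̃ + h̃d̃, f̃h̃ = 0, h̃g̃ = 0 and h̃² = 0 hold. -/
noncomputable section
attribute [local instance] Classical.propDecidable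

open DirectSum

universe u v w

/-- Directed paths in a digraph on `ι` with edge relation `E`. -/
inductive MPath {ι : Type v} (E : ι → ι → Prop) : ι → ι → Type v
  | nil (α : ι) : MPath E α α
  | cons {α β γ : ι} : E α β → MPath E β γ → MPath E α γ

section Morse

variable (R : Type u) [Ring R] (ι : Type v) [DecidableEq ι]
  (V : ι → Type w) [∀ α, AddCommGroup (V α)] [∀ α, Module R (V α)]

/-- The linear endomorphism of `⨁ α, V α` with components `D α β : V α →ₗ[R] V β`
(by convention `0` on summands whose family of components has infinite support). -/
def toLin (D : ∀ α β, V α →ₗ[R] V β) : (⨁ α, V α) →ₗ[R] ⨁ α, V α :=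
  DirectSum.toModule R ι _ fun α =>
    if h : {β | D α β ≠ 0}.Finite then
      ∑ β ∈ h.toFinset, (DirectSum.lof R ι V β).comp (D α β)
    else 0

/-- `(deg, V, D)` is a based complex: the components `D α β : C_α → C_β` of the
differential lower degree by one, each column is finite, and the total
differential squares to zero. -/
structure IsBasedComplex (deg : ι → ℤ) (D : ∀ α β, V α →ₗ[R] V β) : Prop where
  deg_cond : ∀ α β, deg β ≠ deg α - 1 → D α β = 0
  fin : ∀ α, {β | D α β ≠ 0}.Finite
  dsq : toLin R ι V D ∘ₗ toLin R ι V D = 0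

/-- Edges of the Morse graph `G^M(C)`: edges of `G(C)` not in `M` together with
the reversals of the edges in `M`. -/
def MorseEdge (D : ∀ α β, V α →ₗ[R] V β) (M : Set (ι × ι)) (α β : ι) : Prop :=
  (D α β ≠ 0 ∧ (α, β) ∉ M) ∨ (β, α) ∈ M

/-- `M` is a Morse matching on the based complex `(deg, V, D)`. -/
structure IsMorseMatching (deg : ι → ℤ) (D : ∀ α β, V α →ₗ[R] V β)
    (M : Set (ι × ι)) : Prop where
  edge : ∀ e ∈ M, D e.1 e.2 ≠ 0
  iso : ∀ e ∈ M, Function.Bijective (D e.1 e.2)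
  matching : ∀ e ∈ M, ∀ e' ∈ M,
    e.1 = e'.1 ∨ e.1 = e'.2 ∨ e.2 = e'.1 ∨ e.2 = e'.2 → e = e'
  wf : ∃ r : ι → ι → Prop, WellFounded r ∧ (∀ a b c, r a b → r b c → r a c) ∧
    ∀ α β γ, deg γ = deg α →
      MorseEdge R ι V D M α β → MorseEdge R ι V D M β γ → r γ α

end Morse

/-- The set `M⁰` of vertices not incident to any edge of `M`. -/
def MZero {ι : Type v} (M : Set (ι × ι)) : Set ι := {α | ∀ β, (α, β) ∉ M ∧ (β, α) ∉ M}

section Morse2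

variable (R : Type u) [Ring R] (ι : Type v) [DecidableEq ι]
  (V : ι → Type w) [∀ α, AddCommGroup (V α)] [∀ α, Module R (V α)]

/-- The differential `d̃` of `C̃`, keeping only the components of edges in `M`. -/
def dTilde (D : ∀ α β, V α →ₗ[R] V β) (M : Set (ι × ι)) :
    (⨁ α, V α) →ₗ[R] ⨁ α, V α :=
  toLin R ι V fun α β => if (α, β) ∈ M then D α β else 0

/-- The degree one map `h̃`, sending `x ∈ C_α` to `-d⁻¹_{α,β} x` when `β → α ∈ M`. -/
def hTilde (D : ∀ α β, V α →ₗ[R] V β) (M : Set (ι × ι)) :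
    (⨁ α, V α) →ₗ[R] ⨁ α, V α :=
  DirectSum.toModule R ι _ fun α =>
    if h : ∃ β, (β, α) ∈ M ∧ Function.Bijective (D β α) then
      -((DirectSum.lof R ι V h.choose).comp
        (LinearEquiv.ofBijective (D h.choose α) h.choose_spec.2).symm.toLinearMap)
    else 0

/-- The projection `f̃ : C̃ → C̃^M`. -/
def fTilde (M : Set (ι × ι)) : (⨁ α, V α) →ₗ[R] ⨁ s : MZero M, V s.1 :=
  DirectSum.toModule R ι _ fun α =>
    if h : α ∈ MZero M then
      DirectSum.lof R (MZero M) (fun s => V s.1) ⟨α, h⟩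
    else 0

/-- The inclusion `g̃ : C̃^M → C̃`. -/
def gTilde (M : Set (ι × ι)) : (⨁ s : MZero M, V s.1) →ₗ[R] ⨁ α, V α :=
  DirectSum.toModule R (MZero M) _ fun s => DirectSum.lof R ι V s.1

/-- The map attached to an edge `σ → τ` of the Morse graph: `-d⁻¹_{σ,τ}` if it is
the reversal of an edge of `M`, and the component `d_{τ,σ}` otherwise. -/
def edgeMap (D : ∀ α β, V α →ₗ[R] V β) (M : Set (ι × ι)) (σ τ : ι) :
    V σ →ₗ[R] V τ :=
  if h : (τ, σ) ∈ M ∧ Function.Bijective (D τ σ) then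
    -(LinearEquiv.ofBijective (D τ σ) h.2).symm.toLinearMap
  else D σ τ

/-- The map `C_α → C_β` attached to a directed path in the Morse graph. -/
def pathMap (D : ∀ α β, V α →ₗ[R] V β) (M : Set (ι × ι)) :
    {α β : ι} → MPath (MorseEdge R ι V D M) α β → (V α →ₗ[R] V β)
  | _, _, .nil _ => LinearMap.id
  | _, _, .cons _e p => (pathMap D M p).comp (edgeMap R ι V D M _ _)

/-- `Γ_{β,α} : C_α → C_β`, the sum over all directed paths from `α` to `β` in the
Morse graph of the associated path maps. -/
def Gamma (D : ∀ α β, V α →ₗ[R] V β) (M : Set (ι × ι)) (α β : ι) :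
    V α →ₗ[R] V β :=
  ∑ᶠ p : MPath (MorseEdge R ι V D M) α β, pathMap R ι V D M p

end Morse2
section Contraction

variable {R : Type u} [Ring R] {ι : Type v}
  {V : ι → Type w} [∀ α, AddCommGroup (V α)] [∀ α, Module R (V α)]
  {deg : ι → ℤ} {D : ∀ α β, V α →ₗ[R] V β} {M : Set (ι × ι)}

theorem IsMorseMatching.target_unique (hM : IsMorseMatching R ι V deg D M) {α β γ : ι}
    (h : (α, β) ∈ M) (h' : (α, γ) ∈ M) : β = γ :=
  (Prod.ext_iff.1 (hM.matching _ h _ h' (Or.inl rfl))).2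

theorem IsMorseMatching.source_unique (hM : IsMorseMatching R ι V deg D M) {α β γ : ι}
    (h : (β, α) ∈ M) (h' : (γ, α) ∈ M) : β = γ :=
  (Prod.ext_iff.1 (hM.matching _ h _ h' (Or.inr (Or.inr (Or.inr rfl))))).1

theorem mem_MZero_or_source_or_target (M : Set (ι × ι)) (α : ι) :
    α ∈ MZero M ∨ (∃ β, (α, β) ∈ M) ∨ ∃ β, (β, α) ∈ M := by
  by_contra! h
  exact h.1 fun β => ⟨h.2.1 β, h.2.2 β⟩

variable [DecidableEq ι]

/-- A vertex is not both the target and the source of edges of a Morse matching. -/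
theorem IsMorseMatching.not_mem_of_mem (hC : IsBasedComplex R ι V deg D)
    (hM : IsMorseMatching R ι V deg D M) {α β γ : ι} (h : (β, α) ∈ M) : (α, γ) ∉ M := by
  intro h'
  have e : β = α :=
    (Prod.ext_iff.1 (hM.matching _ h _ h' (Or.inr (Or.inr (Or.inl rfl))))).1
  subst e
  exact hM.edge _ h (hC.deg_cond _ _ (by dsimp only; omega))

theorem dTilde_lof_of_mem (hM : IsMorseMatching R ι V deg D M) {α β : ι} (h : (α, β) ∈ M)
    (x : V α) : dTilde R ι V D M (lof R ι V α x) = lof R ι V β (D α β x) := by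
  have hs : {γ | (if (α, γ) ∈ M then D α γ else 0) ≠ 0} = {β} := by
    ext γ
    by_cases hγ : (α, γ) ∈ M
    · obtain rfl := hM.target_unique h hγ
      simpa [hγ] using hM.edge _ h
    · have : γ ≠ β := by rintro rfl; exact hγ h
      simp [hγ, this]
  have hf : {γ | (if (α, γ) ∈ M then D α γ else 0) ≠ 0}.Finite := hs ▸ Set.finite_singleton β
  have ht : hf.toFinset = {β} := by
    rw [← Finset.coe_inj, Set.Finite.coe_toFinset, hs, Finset.coe_singleton]
  rw [dTilde, toLin, toModule_lof, dif_pos hf, ht]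
  simp [h]

theorem dTilde_lof_of_forall_notMem {α : ι} (h : ∀ β, (α, β) ∉ M) (x : V α) :
    dTilde R ι V D M (lof R ι V α x) = 0 := by
  simp [dTilde, toLin, toModule_lof, h]

theorem hTilde_lof_of_mem (hM : IsMorseMatching R ι V deg D M) {α β : ι} (h : (β, α) ∈ M)
    (x : V β) : hTilde R ι V D M (lof R ι V α (D β α x)) = -lof R ι V β x := by
  have he : ∃ γ, (γ, α) ∈ M ∧ Function.Bijective (D γ α) := ⟨β, h, hM.iso _ h⟩
  rw [hTilde, toModule_lof, dif_pos he]
  obtain rfl := hM.source_unique h he.choose_spec.1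
  simp only [LinearMap.neg_apply, LinearMap.comp_apply, LinearEquiv.coe_coe]
  congr 2
  exact (LinearEquiv.ofBijective _ he.choose_spec.2).symm_apply_apply x

theorem hTilde_lof_of_forall_notMem {α : ι} (h : ∀ β, (β, α) ∉ M) (x : V α) :
    hTilde R ι V D M (lof R ι V α x) = 0 := by
  simp [hTilde, toModule_lof, h]

theorem fTilde_lof_of_mem {α : ι} (h : α ∈ MZero M) (x : V α) :
    fTilde R ι V M (lof R ι V α x) = lof R (MZero M) (fun s => V s.1) ⟨α, h⟩ x := by
  simp [fTilde, toModule_lof, h]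

theorem fTilde_lof_of_notMem {α : ι} (h : α ∉ MZero M) (x : V α) :
    fTilde R ι V M (lof R ι V α x) = 0 := by
  simp [fTilde, toModule_lof, h]

theorem gTilde_lof (s : MZero M) (x : V s.1) :
    gTilde R ι V M (lof R (MZero M) (fun s => V s.1) s x) = lof R ι V s.1 x := by
  simp [gTilde, toModule_lof]

end Contraction

theorem morse_contraction
    (R : Type u) [Ring R] (ι : Type v) [DecidableEq ι]
    (V : ι → Type w) [∀ α, AddCommGroup (V α)] [∀ α, Module R (V α)]
    (deg : ι → ℤ) (D : ∀ α β, V α →ₗ[R] V β) (M : Set (ι × ι))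
    (hC : IsBasedComplex R ι V deg D) (hM : IsMorseMatching R ι V deg D M) :
    fTilde R ι V M ∘ₗ dTilde R ι V D M = 0 ∧
    dTilde R ι V D M ∘ₗ gTilde R ι V M = 0 ∧
    fTilde R ι V M ∘ₗ gTilde R ι V M = LinearMap.id ∧
    gTilde R ι V M ∘ₗ fTilde R ι V M =
      LinearMap.id + dTilde R ι V D M ∘ₗ hTilde R ι V D M
        + hTilde R ι V D M ∘ₗ dTilde R ι V D M ∧
    fTilde R ι V M ∘ₗ hTilde R ι V D M = 0 ∧
    hTilde R ι V D M ∘ₗ gTilde R ι V M = 0 ∧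
    hTilde R ι V D M ∘ₗ hTilde R ι V D M = 0 := by
  have hf_source : ∀ {α β}, (α, β) ∈ M → ∀ x, fTilde R ι V M (lof R ι V α x) = 0 :=
    fun h => fTilde_lof_of_notMem fun h0 => (h0 _).1 h
  have hf_target : ∀ {α β}, (β, α) ∈ M → ∀ x, fTilde R ι V M (lof R ι V α x) = 0 :=
    fun h => fTilde_lof_of_notMem fun h0 => (h0 _).2 h
  have hd_zero : ∀ {α}, α ∈ MZero M → ∀ x, dTilde R ι V D M (lof R ι V α x) = 0 :=
    fun h => dTilde_lof_of_forall_notMem fun β => (h β).1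
  have hd_target : ∀ {α β}, (β, α) ∈ M → ∀ x, dTilde R ι V D M (lof R ι V α x) = 0 :=
    fun h => dTilde_lof_of_forall_notMem fun _ => hM.not_mem_of_mem hC h
  have hh_zero : ∀ {α}, α ∈ MZero M → ∀ x, hTilde R ι V D M (lof R ι V α x) = 0 :=
    fun h => hTilde_lof_of_forall_notMem fun β => (h β).2
  have hh_source : ∀ {α β}, (α, β) ∈ M → ∀ x, hTilde R ι V D M (lof R ι V α x) = 0 :=
    fun h => hTilde_lof_of_forall_notMem fun _ h' => hM.not_mem_of_mem hC h' h
  refine ⟨?_, ?_, ?_, ?_, ?_, ?_, ?_⟩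
  · refine DirectSum.linearMap_ext R fun α => LinearMap.ext fun x => ?_
    simp only [LinearMap.comp_apply, LinearMap.zero_apply]
    rcases mem_MZero_or_source_or_target M α with h | ⟨β, h⟩ | ⟨β, h⟩
    · rw [hd_zero h, map_zero]
    · rw [dTilde_lof_of_mem hM h, hf_target h]
    · rw [hd_target h, map_zero]
  · refine DirectSum.linearMap_ext R fun s => LinearMap.ext fun x => ?_
    simp only [LinearMap.comp_apply, LinearMap.zero_apply]
    rw [gTilde_lof, hd_zero s.2]
  · refine DirectSum.linearMap_ext R fun s => LinearMap.ext fun x => ?_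
    simp only [LinearMap.comp_apply, LinearMap.id_apply]
    rw [gTilde_lof, fTilde_lof_of_mem s.2]
  · refine DirectSum.linearMap_ext R fun α => LinearMap.ext fun x => ?_
    simp only [LinearMap.comp_apply, LinearMap.add_apply, LinearMap.id_apply]
    rcases mem_MZero_or_source_or_target M α with h | ⟨β, h⟩ | ⟨β, h⟩
    · rw [fTilde_lof_of_mem h, gTilde_lof, hd_zero h, hh_zero h]
      simp
    · rw [hf_source h, hh_source h, dTilde_lof_of_mem hM h, hTilde_lof_of_mem hM h]
      simp
    · obtain ⟨y, rfl⟩ := (hM.iso _ h).2 x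
      rw [hf_target h, hd_target h, hTilde_lof_of_mem hM h, map_neg, dTilde_lof_of_mem hM h]
      simp
  · refine DirectSum.linearMap_ext R fun α => LinearMap.ext fun x => ?_
    simp only [LinearMap.comp_apply, LinearMap.zero_apply]
    rcases mem_MZero_or_source_or_target M α with h | ⟨β, h⟩ | ⟨β, h⟩
    · rw [hh_zero h, map_zero]
    · rw [hh_source h, map_zero]
    · obtain ⟨y, rfl⟩ := (hM.iso _ h).2 x
      rw [hTilde_lof_of_mem hM h, map_neg, hf_source h, neg_zero]
  · refine DirectSum.linearMap_ext R fun s => LinearMap.ext fun x => ?_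
    simp only [LinearMap.comp_apply, LinearMap.zero_apply]
    rw [gTilde_lof, hh_zero s.2]
  · refine DirectSum.linearMap_ext R fun α => LinearMap.ext fun x => ?_
    simp only [LinearMap.comp_apply, LinearMap.zero_apply]
    rcases mem_MZero_or_source_or_target M α with h | ⟨β, h⟩ | ⟨β, h⟩
    · rw [hh_zero h, map_zero]
    · rw [hh_source h, map_zero]
    · obtain ⟨y, rfl⟩ := (hM.iso _ h).2 x
      rw [hTilde_lof_of_mem hM h, map_neg, hh_source h, neg_zero]
end
end

section
/- Let C be a based complex of R-modules with a Morse matching M, and let d̃ and h̃ be the associated maps on C̃. For a basis element x ∈ C_α one has d̃h̃(x) = −x if there is an edge β → α in M and d̃h̃(x) = 0 otherwise; and h̃d̃(x) = −x if there is an edge α → β in M and h̃d̃(x) = 0 otherwise. Consequently g̃f̃ = 1 + d̃h̃ + h̃d̃. -/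
noncomputable section
attribute [local instance] Classical.propDecidable

open DirectSum

universe u v w

section MatchedMaps

variable {R : Type u} [Ring R] {ι : Type v}
  {V : ι → Type w} [∀ α, AddCommGroup (V α)] [∀ α, Module R (V α)]
  {deg : ι → ℤ} {D : ∀ α β, V α →ₗ[R] V β} {M : Set (ι × ι)}

namespace IsMorseMatching

theorem target_unique_s4 (hM : IsMorseMatching R ι V deg D M) {α β γ : ι}
    (hβ : (α, β) ∈ M) (hγ : (α, γ) ∈ M) : β = γ :=
  congrArg Prod.snd (hM.matching _ hβ _ hγ (.inl rfl))

theorem source_unique_s4 (hM : IsMorseMatching R ι V deg D M) {α β γ : ι}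
    (hβ : (β, α) ∈ M) (hγ : (γ, α) ∈ M) : β = γ :=
  congrArg Prod.fst (hM.matching _ hβ _ hγ (.inr (.inr (.inr rfl))))

end IsMorseMatching

variable [DecidableEq ι]

theorem toLin_lof_of_forall_ne {α β : ι} (h : ∀ γ, γ ≠ β → D α γ = 0) (x : V α) :
    toLin R ι V D (DirectSum.lof R ι V α x) = DirectSum.lof R ι V β (D α β x) := by
  have hsub : {γ | D α γ ≠ 0} ⊆ {β} := fun γ hγ => by
    by_contra hne
    exact hγ (h γ hne)
  have hfin : {γ | D α γ ≠ 0}.Finite := (Set.finite_singleton β).subset hsub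
  rw [toLin, DirectSum.toModule_lof, dif_pos hfin, LinearMap.sum_apply,
    Finset.sum_eq_single β]
  · rfl
  · intro γ _ hne
    simp [h γ hne]
  · intro hβ
    have : D α β = 0 := by simpa using hβ
    simp [this]

theorem toLin_lof_of_forall_eq_zero {α : ι} (h : ∀ γ, D α γ = 0) (x : V α) :
    toLin R ι V D (DirectSum.lof R ι V α x) = 0 := by
  rw [toLin_lof_of_forall_ne (β := α) fun γ _ => h γ]
  simp [h]

namespace IsMorseMatching

theorem not_source_of_target (hC : IsBasedComplex R ι V deg D)
    (hM : IsMorseMatching R ι V deg D M) {α β γ : ι} (hβ : (β, α) ∈ M) : (α, γ) ∉ M := by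
  intro hγ
  obtain rfl : β = α :=
    congrArg Prod.fst (hM.matching _ hβ _ hγ (.inr (.inr (.inl rfl))))
  exact hM.edge _ hβ (hC.deg_cond _ _ (by lia))

theorem dTilde_lof (hM : IsMorseMatching R ι V deg D M) {α β : ι} (h : (α, β) ∈ M) (x : V α) :
    dTilde R ι V D M (DirectSum.lof R ι V α x) = DirectSum.lof R ι V β (D α β x) := by
  rw [dTilde, toLin_lof_of_forall_ne (β := β), if_pos h]
  intro γ hne
  exact if_neg fun hγ => hne (hM.target_unique_s4 hγ h)

theorem hTilde_lof_apply (hM : IsMorseMatching R ι V deg D M) {α β : ι} (h : (α, β) ∈ M)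
    (x : V α) :
    hTilde R ι V D M (DirectSum.lof R ι V β (D α β x)) = -DirectSum.lof R ι V α x := by
  have hex : ∃ γ, (γ, β) ∈ M ∧ Function.Bijective (D γ β) := ⟨α, h, hM.iso _ h⟩
  rw [hTilde, DirectSum.toModule_lof, dif_pos hex]
  have hα : α = hex.choose := hM.source_unique_s4 h hex.choose_spec.1
  have hbij := hex.choose_spec.2
  simp only [LinearMap.neg_apply, LinearMap.comp_apply, LinearEquiv.coe_coe, neg_inj]
  change DirectSum.lof R ι V hex.choose
    ((LinearEquiv.ofBijective (D hex.choose β) hbij).symm (D α β x)) = _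
  revert hbij
  generalize hex.choose = γ at hα
  subst hα
  intro hbij
  exact congrArg _ ((LinearEquiv.ofBijective (D α β) hbij).symm_apply_apply x)

end IsMorseMatching

theorem dTilde_lof_eq_zero {α : ι} (h : ¬ ∃ β, (α, β) ∈ M) (x : V α) :
    dTilde R ι V D M (DirectSum.lof R ι V α x) = 0 :=
  toLin_lof_of_forall_eq_zero (fun γ => if_neg fun hγ => h ⟨γ, hγ⟩) x

theorem hTilde_lof_eq_zero {α : ι} (h : ¬ ∃ β, (β, α) ∈ M) (x : V α) :
    hTilde R ι V D M (DirectSum.lof R ι V α x) = 0 := by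
  rw [hTilde, DirectSum.toModule_lof, dif_neg fun ⟨β, hβ, _⟩ => h ⟨β, hβ⟩,
    LinearMap.zero_apply]

theorem gTilde_fTilde_lof {α : ι} (h : α ∈ MZero M) (x : V α) :
    gTilde R ι V M (fTilde R ι V M (DirectSum.lof R ι V α x)) = DirectSum.lof R ι V α x := by
  rw [fTilde, DirectSum.toModule_lof, dif_pos h, gTilde]
  exact DirectSum.toModule_lof (ι := MZero M) (M := fun s => V s.1) R ⟨α, h⟩ x

theorem fTilde_lof_eq_zero {α : ι} (h : α ∉ MZero M) (x : V α) :
    fTilde R ι V M (DirectSum.lof R ι V α x) = 0 := by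
  rw [fTilde, DirectSum.toModule_lof, dif_neg h, LinearMap.zero_apply]

namespace IsMorseMatching

theorem dTilde_hTilde_lof (hM : IsMorseMatching R ι V deg D M) {α β : ι} (h : (β, α) ∈ M)
    (x : V α) :
    dTilde R ι V D M (hTilde R ι V D M (DirectSum.lof R ι V α x)) =
      -DirectSum.lof R ι V α x := by
  obtain ⟨y, rfl⟩ := (hM.iso _ h).2 x
  rw [hM.hTilde_lof_apply h, map_neg, hM.dTilde_lof h]

theorem hTilde_dTilde_lof (hM : IsMorseMatching R ι V deg D M) {α β : ι} (h : (α, β) ∈ M)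
    (x : V α) :
    hTilde R ι V D M (dTilde R ι V D M (DirectSum.lof R ι V α x)) =
      -DirectSum.lof R ι V α x := by
  rw [hM.dTilde_lof h, hM.hTilde_lof_apply h]

end IsMorseMatching

end MatchedMaps

theorem gTilde_fTilde_homotopy
    (R : Type u) [Ring R] (ι : Type v) [DecidableEq ι]
    (V : ι → Type w) [∀ α, AddCommGroup (V α)] [∀ α, Module R (V α)]
    (deg : ι → ℤ) (D : ∀ α β, V α →ₗ[R] V β) (M : Set (ι × ι))
    (hC : IsBasedComplex R ι V deg D) (hM : IsMorseMatching R ι V deg D M) :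
    (∀ (α : ι) (x : V α),
      ((∃ β, (β, α) ∈ M) →
        dTilde R ι V D M (hTilde R ι V D M (DirectSum.lof R ι V α x)) =
          -(DirectSum.lof R ι V α x)) ∧
      ((¬ ∃ β, (β, α) ∈ M) →
        dTilde R ι V D M (hTilde R ι V D M (DirectSum.lof R ι V α x)) = 0)) ∧
    (∀ (α : ι) (x : V α),
      ((∃ β, (α, β) ∈ M) →
        hTilde R ι V D M (dTilde R ι V D M (DirectSum.lof R ι V α x)) =
          -(DirectSum.lof R ι V α x)) ∧
      ((¬ ∃ β, (α, β) ∈ M) →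
        hTilde R ι V D M (dTilde R ι V D M (DirectSum.lof R ι V α x)) = 0)) ∧
    gTilde R ι V M ∘ₗ fTilde R ι V M =
      LinearMap.id + dTilde R ι V D M ∘ₗ hTilde R ι V D M
        + hTilde R ι V D M ∘ₗ dTilde R ι V D M := by
  have hd0 : ∀ (α : ι) (x : V α), (¬ ∃ β, (β, α) ∈ M) →
      dTilde R ι V D M (hTilde R ι V D M (DirectSum.lof R ι V α x)) = 0 := fun α x h => by
    rw [hTilde_lof_eq_zero h, map_zero]
  have hh0 : ∀ (α : ι) (x : V α), (¬ ∃ β, (α, β) ∈ M) →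
      hTilde R ι V D M (dTilde R ι V D M (DirectSum.lof R ι V α x)) = 0 := fun α x h => by
    rw [dTilde_lof_eq_zero h, map_zero]
  refine ⟨fun α x => ⟨fun ⟨β, h⟩ => hM.dTilde_hTilde_lof h x, hd0 α x⟩,
    fun α x => ⟨fun ⟨β, h⟩ => hM.hTilde_dTilde_lof h x, hh0 α x⟩, ?_⟩
  refine DirectSum.linearMap_ext R fun α => LinearMap.ext fun x => ?_
  simp only [LinearMap.comp_apply, LinearMap.add_apply, LinearMap.id_apply]
  by_cases h₁ : ∃ β, (β, α) ∈ M
  · obtain ⟨β, h⟩ := h₁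
    rw [fTilde_lof_eq_zero fun h0 => (h0 β).2 h, map_zero, hM.dTilde_hTilde_lof h,
      hh0 α x fun ⟨_, hγ⟩ => hM.not_source_of_target hC h hγ]
    simp
  · rw [hd0 α x h₁]
    by_cases h₂ : ∃ β, (α, β) ∈ M
    · obtain ⟨β, h⟩ := h₂
      rw [fTilde_lof_eq_zero fun h0 => (h0 β).1 h, map_zero, hM.hTilde_dTilde_lof h]
      simp
    · rw [hh0 α x h₂, gTilde_fTilde_lof fun β => ⟨fun h => h₂ ⟨β, h⟩, fun h => h₁ ⟨β, h⟩⟩]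
      simp
end
end

section
/- Let (D, C, f, g, h) be a contraction of chain complexes of R-modules, let t be a perturbation of C such that ht is locally nilpotent (for every x there is n with (ht)^n(x) = 0), and set S = Σ_{n≥0} t(ht)^n and t' = fSg. Then (d_D + t')² = 0, i.e. t' is a perturbation of D. -/
noncomputable section

open DirectSum

universe u v

/-- The geometric series `∑ φⁿ` of a locally nilpotent endomorphism `φ`, applied to `x`, has
only finitely many nonzero terms. -/
lemma finite_support_comp_pow_of_locallyNilpotent {R M N : Type*} [Ring R]
    [AddCommGroup M] [Module R M] [AddCommGroup N] [Module R N]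
    (t : M →ₗ[R] N) {φ : M →ₗ[R] M} (hφ : ∀ x, ∃ n : ℕ, (φ ^ n) x = 0) (x : M) :
    (Function.support fun n : ℕ => t ((φ ^ n) x)).Finite := by
  obtain ⟨n, hn⟩ := hφ x
  refine (Set.finite_Iio n).subset fun m hm => ?_
  by_contra hnm
  refine hm ?_
  obtain ⟨k, rfl⟩ := Nat.exists_eq_add_of_le' (not_lt.mp hnm)
  simp [pow_add, hn]

/-- The additive map `∑ t φⁿ` for a locally nilpotent endomorphism `φ`. -/
def compGeomSum {R M N : Type*} [Ring R]
    [AddCommGroup M] [Module R M] [AddCommGroup N] [Module R N]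
    (t : M →ₗ[R] N) {φ : M →ₗ[R] M} (hφ : ∀ x, ∃ n : ℕ, (φ ^ n) x = 0) : M →+ N :=
  AddMonoidHom.mk' (fun x => ∑ᶠ n : ℕ, t ((φ ^ n) x)) fun x y => by
    simp only [map_add]
    exact finsum_add_distrib (finite_support_comp_pow_of_locallyNilpotent t hφ x)
      (finite_support_comp_pow_of_locallyNilpotent t hφ y)

lemma compGeomSum_apply {R M N : Type*} [Ring R]
    [AddCommGroup M] [Module R M] [AddCommGroup N] [Module R N]
    (t : M →ₗ[R] N) {φ : M →ₗ[R] M} (hφ : ∀ x, ∃ n : ℕ, (φ ^ n) x = 0) (x : M) :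
    compGeomSum t hφ x = ∑ᶠ n : ℕ, t ((φ ^ n) x) :=
  rfl

lemma compGeomSum_eq_add_apply {R M N : Type*} [Ring R]
    [AddCommGroup M] [Module R M] [AddCommGroup N] [Module R N]
    (t : M →ₗ[R] N) {φ : M →ₗ[R] M} (hφ : ∀ x, ∃ n : ℕ, (φ ^ n) x = 0) (x : M) :
    compGeomSum t hφ x = t x + compGeomSum t hφ (φ x) := by
  obtain ⟨n, hn⟩ := hφ x
  have eq_sum (y : M) (k : ℕ) (hk : (φ ^ k) y = 0) :
      compGeomSum t hφ y = ∑ i ∈ Finset.range k, t ((φ ^ i) y) := by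
    refine finsum_eq_finsetSum_of_support_subset _ fun m hm => ?_
    by_contra hkm
    refine hm ?_
    obtain ⟨l, rfl⟩ := Nat.exists_eq_add_of_le' (not_lt.mp fun h => hkm (by simpa using h))
    simp [pow_add, hk]
  rw [eq_sum x (n + 1) (by simp [pow_succ', hn]),
    eq_sum (φ x) n (by rw [← Module.End.mul_apply, ← pow_succ, pow_succ']; simp [hn]),
    Finset.sum_range_succ']
  simp [pow_succ, add_comm]

lemma compGeomSum_comp_eq_add {R M N : Type*} [Ring R]
    [AddCommGroup M] [Module R M] [AddCommGroup N] [Module R N]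
    (t : M →ₗ[R] N) (h : N →ₗ[R] M) (hφ : ∀ x, ∃ n : ℕ, ((h ∘ₗ t) ^ n) x = 0) (x : M) :
    compGeomSum t hφ x = t (x + h (compGeomSum t hφ x)) := by
  obtain ⟨n, hn⟩ := hφ x
  induction n generalizing x with
  | zero =>
    obtain rfl : x = 0 := by simpa using hn
    simp
  | succ n ih =>
    have key := ih (h (t x)) (by simpa [pow_succ] using hn)
    rw [compGeomSum_eq_add_apply t hφ x, LinearMap.comp_apply, map_add t, map_add h, ← key]

/-- The identity `dS + Sd + S(1 + dh + hd)S = 0` for `S = ∑ t(ht)ⁿ`. -/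
lemma compGeomSum_perturbation {R M : Type*} [Ring R] [AddCommGroup M] [Module R M]
    (d t h : M →ₗ[R] M) (hd : d ∘ₗ d = 0) (ht : (d + t) ∘ₗ (d + t) = 0)
    (hφ : ∀ x, ∃ n : ℕ, ((h ∘ₗ t) ^ n) x = 0) (x : M) :
    d (compGeomSum t hφ x) + compGeomSum t hφ (d x) +
      compGeomSum t hφ ((LinearMap.id + d ∘ₗ h + h ∘ₗ d : M →ₗ[R] M) (compGeomSum t hφ x)) = 0 := by
  set S := compGeomSum t hφ
  set u := x + h (S x)
  have htu : t u = S x := (compGeomSum_comp_eq_add t h hφ x).symm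
  have hS (w : M) : S w = t w + S (h (t w)) := compGeomSum_eq_add_apply t hφ w
  have hdd : d (d u) = 0 := LinearMap.congr_fun hd u
  have hsum : d (S x) + t (d u) + t (S x) = 0 := by
    have := LinearMap.congr_fun ht u
    simp only [LinearMap.comp_apply, LinearMap.add_apply, map_add, hdd, htu,
      LinearMap.zero_apply] at this
    rw [← this]
    abel
  have hSh : S (h (d (S x))) + S (h (t (d u))) + S (h (t (S x))) = 0 := by
    simpa using congrArg (fun y => S (h y)) hsum
  have hdu : S (d u) = S (d x) + S (d (h (S x))) := by simp [u]
  calc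
    _ = d (S x) + S (h (d (S x))) + S (d u) + S (S x) := by
      simp only [LinearMap.add_apply, LinearMap.id_apply, LinearMap.comp_apply, map_add, hdu]
      abel
    _ = (d (S x) + t (d u) + t (S x)) +
        (S (h (d (S x))) + S (h (t (d u))) + S (h (t (S x)))) := by
      rw [hS (d u), hS (S x)]
      abel
    _ = 0 := by rw [hsum, hSh, add_zero]

theorem perturbed_differential_squares_to_zero
    (R : Type u) [Ring R] (Cf Df : ℤ → Type v)
    [∀ n, AddCommGroup (Cf n)] [∀ n, Module R (Cf n)]
    [∀ n, AddCommGroup (Df n)] [∀ n, Module R (Df n)]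
    (dC : (⨁ n, Cf n) →ₗ[R] ⨁ n, Cf n) (dD : (⨁ n, Df n) →ₗ[R] ⨁ n, Df n)
    (f : (⨁ n, Cf n) →ₗ[R] ⨁ n, Df n) (g : (⨁ n, Df n) →ₗ[R] ⨁ n, Cf n)
    (h : (⨁ n, Cf n) →ₗ[R] ⨁ n, Cf n)
    (hcon : IsContraction R Cf Df dC dD f g h)
    -- `t` is a perturbation of `C`
    (t : (⨁ n, Cf n) →ₗ[R] ⨁ n, Cf n)
    (ht_deg : HasDeg R Cf Cf t (-1))
    (ht_sq : (dC + t) ∘ₗ (dC + t) = 0)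
    -- `ht` is locally nilpotent
    (hnil : ∀ x : ⨁ n, Cf n, ∃ n : ℕ, ((h ∘ₗ t) ^ n) x = 0)
    -- `S = Σ_{n ≥ 0} t(ht)ⁿ` and `t' = fSg`
    (S : (⨁ n, Cf n) → ⨁ n, Cf n)
    (hS : ∀ x, S x = ∑ᶠ n : ℕ, t (((h ∘ₗ t) ^ n) x))
    (t' : (⨁ n, Df n) → ⨁ n, Df n)
    (ht' : ∀ y, t' y = f (S (g y))) :
    -- `(dD + t')² = 0`, i.e. `t'` is a perturbation of `D`
    ∀ y : ⨁ n, Df n, dD (dD y + t' y) + t' (dD y + t' y) = 0 := by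
  intro y
  have ht'' (y : ⨁ n, Df n) : t' y = f (compGeomSum t hnil (g y)) := by
    rw [ht', hS, compGeomSum_apply]
  have key := congrArg f (compGeomSum_perturbation dC t h hcon.dC_sq ht_sq hnil (g y))
  rw [← hcon.gf] at key
  simp only [map_add, map_zero, LinearMap.comp_apply] at key
  have hd : dD (dD y) = 0 := LinearMap.congr_fun hcon.dD_sq y
  have hf (x : ⨁ n, Cf n) : f (dC x) = dD (f x) := LinearMap.congr_fun hcon.f_chain x
  have hg : g (dD y) = dC (g y) := LinearMap.congr_fun hcon.g_chain y
  simp only [ht'', map_add, hd, hg, zero_add, ← hf]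
  rw [← key]
  abel
end
end

section
/- Let (D, C, f, g, h) be a contraction of chain complexes of R-modules, let t be a perturbation of C such that ht is locally nilpotent, and set S = Σ_{n≥0} t(ht)^n, f' = f + fSh, g' = g + hSg, t' = fSg. Then f' : C^t → D^{t'} and g' : D^{t'} → C^t are chain maps (i.e. f'(d_C + t) = (d_D + t')f' and g'(d_D + t') = (d_C + t)g') and f'g' = 1. -/
noncomputable section

open DirectSum

universe u v

section PerturbationSeries

variable {R : Type*} [Ring R] {C D : Type*} [AddCommGroup C] [Module R C]
  [AddCommGroup D] [Module R D]

theorem finsum_apply_pow_eq_sum_range (a t : C →ₗ[R] C) {x : C} {N : ℕ}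
    (hN : (a ^ N) x = 0) :
    ∑ᶠ n : ℕ, t ((a ^ n) x) = ∑ n ∈ Finset.range N, t ((a ^ n) x) := by
  refine finsum_eq_sum_of_support_subset _ fun n hn ↦ ?_
  contrapose! hn
  have hNn : N ≤ n := by simpa using hn
  simp [Module.End.pow_map_zero_of_le hNn hN]

/-- The series `∑ n, t (h t) ^ n` as a linear map, for `h t` locally nilpotent. -/
def perturbationSeries (h t : C →ₗ[R] C) (hnil : ∀ x, ∃ n : ℕ, ((h ∘ₗ t) ^ n) x = 0) :
    C →ₗ[R] C where
  toFun x := ∑ᶠ n : ℕ, t (((h ∘ₗ t) ^ n) x)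
  map_add' x y := by
    obtain ⟨N, hN⟩ := hnil x
    obtain ⟨M, hM⟩ := hnil y
    have hx := Module.End.pow_map_zero_of_le (le_max_left N M) hN
    have hy := Module.End.pow_map_zero_of_le (le_max_right N M) hM
    rw [finsum_apply_pow_eq_sum_range _ t hx, finsum_apply_pow_eq_sum_range _ t hy,
      finsum_apply_pow_eq_sum_range _ t (N := max N M) (by rw [map_add, hx, hy, add_zero]),
      ← Finset.sum_add_distrib]
    simp only [map_add]
  map_smul' r x := by
    obtain ⟨N, hN⟩ := hnil x
    rw [finsum_apply_pow_eq_sum_range _ t hN,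
      finsum_apply_pow_eq_sum_range _ t (N := N) (by rw [map_smul, hN, smul_zero])]
    simp only [map_smul, Finset.smul_sum, RingHom.id_apply]

variable {h t : C →ₗ[R] C} (hnil : ∀ x, ∃ n : ℕ, ((h ∘ₗ t) ^ n) x = 0)

theorem perturbationSeries_eq_sum_range {x : C} {N : ℕ} (hN : ((h ∘ₗ t) ^ N) x = 0) :
    perturbationSeries h t hnil x = ∑ n ∈ Finset.range N, t (((h ∘ₗ t) ^ n) x) :=
  finsum_apply_pow_eq_sum_range _ t hN

theorem perturbationSeries_apply_eq_add_left (x : C) :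
    perturbationSeries h t hnil x = t x + t (h (perturbationSeries h t hnil x)) := by
  obtain ⟨N, hN⟩ := hnil x
  conv_lhs => rw [perturbationSeries_eq_sum_range hnil
    (Module.End.pow_map_zero_of_le N.le_succ hN), Finset.sum_range_succ']
  rw [perturbationSeries_eq_sum_range hnil hN, add_comm]
  simp only [pow_succ', Module.End.mul_apply, LinearMap.comp_apply, map_sum, pow_zero,
    Module.End.one_apply]

theorem perturbationSeries_apply_eq_add_right (x : C) :
    perturbationSeries h t hnil x = t x + perturbationSeries h t hnil (h (t x)) := by
  obtain ⟨N, hN⟩ := hnil x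
  have hN' : ((h ∘ₗ t) ^ (N + 1)) x = 0 := Module.End.pow_map_zero_of_le N.le_succ hN
  rw [perturbationSeries_eq_sum_range hnil hN', Finset.sum_range_succ',
    perturbationSeries_eq_sum_range hnil (x := h (t x)) (N := N)
      (by simpa only [pow_succ, Module.End.mul_apply, LinearMap.comp_apply] using hN'),
    add_comm]
  simp only [pow_succ, Module.End.mul_apply, LinearMap.comp_apply, pow_zero,
    Module.End.one_apply]

/-- If `S = t + t h S = t + S h t` and `gf = 1 + dh + hd`, then `S g f S + S d + d S = 0`. -/
theorem perturbation_comp_add_comp_add_comp_eq_zero {d S : C →ₗ[R] C} {f : C →ₗ[R] D}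
    {g : D →ₗ[R] C} (hgf : ∀ x, g (f x) = x + d (h x) + h (d x)) (hd : ∀ x, d (d x) = 0)
    (hdt : ∀ x, d (d x + t x) + t (d x + t x) = 0)
    (hSl : ∀ x, S x = t x + t (h (S x))) (hSr : ∀ x, S x = t x + S (h (t x))) (x : C) :
    S (g (f (S x))) + S (d x) + d (S x) = 0 := by
  have hu : d (S x) + t (d (x + h (S x))) + t (S x) = 0 := by
    have key := hdt (x + h (S x))
    have hS : t (x + h (S x)) = S x := by rw [map_add, ← hSl]
    rw [hS, map_add, hd, zero_add, map_add, ← add_assoc] at key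
    exact key
  have hv := congrArg (fun z ↦ S (h z)) hu
  have h₁ := hSr (S x)
  have h₂ := hSr (d (x + h (S x)))
  simp only [hgf, map_add, map_zero] at *
  linear_combination (norm := module) hu + hv + h₁ + h₂

end PerturbationSeries

theorem perturbed_chain_maps_and_fg
    (R : Type u) [Ring R] (Cf Df : ℤ → Type v)
    [∀ n, AddCommGroup (Cf n)] [∀ n, Module R (Cf n)]
    [∀ n, AddCommGroup (Df n)] [∀ n, Module R (Df n)]
    (dC : (⨁ n, Cf n) →ₗ[R] ⨁ n, Cf n) (dD : (⨁ n, Df n) →ₗ[R] ⨁ n, Df n)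
    (f : (⨁ n, Cf n) →ₗ[R] ⨁ n, Df n) (g : (⨁ n, Df n) →ₗ[R] ⨁ n, Cf n)
    (h : (⨁ n, Cf n) →ₗ[R] ⨁ n, Cf n)
    (hcon : IsContraction R Cf Df dC dD f g h)
    (t : (⨁ n, Cf n) →ₗ[R] ⨁ n, Cf n)
    (ht_deg : HasDeg R Cf Cf t (-1))
    (ht_sq : (dC + t) ∘ₗ (dC + t) = 0)
    (hnil : ∀ x : ⨁ n, Cf n, ∃ n : ℕ, ((h ∘ₗ t) ^ n) x = 0)
    (S : (⨁ n, Cf n) → ⨁ n, Cf n)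
    (hS : ∀ x, S x = ∑ᶠ n : ℕ, t (((h ∘ₗ t) ^ n) x))
    (f' : (⨁ n, Cf n) → ⨁ n, Df n)
    (hf' : ∀ x, f' x = f x + f (S (h x)))
    (g' : (⨁ n, Df n) → ⨁ n, Cf n)
    (hg' : ∀ y, g' y = g y + h (S (g y)))
    (t' : (⨁ n, Df n) → ⨁ n, Df n)
    (ht' : ∀ y, t' y = f (S (g y))) :
    -- `f' : C^t → D^{t'}` is a chain map
    (∀ x : ⨁ n, Cf n, f' (dC x + t x) = dD (f' x) + t' (f' x)) ∧
    -- `g' : D^{t'} → C^t` is a chain map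
    (∀ y : ⨁ n, Df n, g' (dD y + t' y) = dC (g' y) + t (g' y)) ∧
    -- `f'g' = 1`
    (∀ y : ⨁ n, Df n, f' (g' y) = y) := by
  obtain rfl : S = perturbationSeries h t hnil := funext hS
  have hf_chain : ∀ x, f (dC x) = dD (f x) := LinearMap.congr_fun hcon.f_chain
  have hg_chain : ∀ y, g (dD y) = dC (g y) := LinearMap.congr_fun hcon.g_chain
  have hfg : ∀ y, f (g y) = y := LinearMap.congr_fun hcon.fg
  have hgf : ∀ x, g (f x) = x + dC (h x) + h (dC x) := LinearMap.congr_fun hcon.gf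
  have hfh : ∀ x, f (h x) = 0 := LinearMap.congr_fun hcon.fh
  have hhg : ∀ y, h (g y) = 0 := LinearMap.congr_fun hcon.hg
  have hhh : ∀ x, h (h x) = 0 := LinearMap.congr_fun hcon.hh
  have hSl := perturbationSeries_apply_eq_add_left hnil
  have hSr := perturbationSeries_apply_eq_add_right hnil
  have key := perturbation_comp_add_comp_add_comp_eq_zero hgf
    (LinearMap.congr_fun hcon.dC_sq) (LinearMap.congr_fun ht_sq) hSl hSr
  generalize perturbationSeries h t hnil = S at *
  refine ⟨fun x ↦ ?_, fun y ↦ ?_, fun y ↦ ?_⟩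
  · have h₁ := congrArg f (key (h x))
    have h₂ := congrArg f (hSr x)
    simp only [hf', ht', map_add, map_zero, ← hf_chain] at h₁ h₂ ⊢
    rw [hgf x]
    simp only [map_add]
    linear_combination (norm := module) -h₁ - h₂
  · have h₁ := congrArg h (key (g y))
    have h₂ := hSl (g y)
    simp only [hg', ht', map_add, map_zero, hg_chain] at h₁ h₂ ⊢
    simp only [hgf (S (g y)), map_add] at h₁ ⊢
    linear_combination (norm := module) h₁ + h₂
  · simp only [hf', hg', map_add, map_zero, hfg, hfh, hhg, hhh, add_zero]
end
end
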